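/- Quadratic form identity for the cubic weight in dimension 3: let g(x) = |x|³ on ℝ³. Then for every smooth compactly supported u : ℝ³ → ℂ whose support does not contain the origin, − ∫_{ℝ³} conj(u) · ( Δ(Δ(g·u)) − 2Δ(g·Δu) + g·Δ(Δu) ) dx = − 24 ∫_{ℝ³} |u(x)|²/|x| dx + 12 ∫_{ℝ³} |x| ( |∇u(x)|² + |ω_x · ∇u(x)|² ) dx, where ω_x = x/|x|. -/

import Mathlib

open scoped ComplexConjugate

/-- The Laplacian on `ℝ^d` (sum of second partial derivatives). -/
noncomputable def laplacian {d : ℕ} {F : Type*} [NormedAddCommGroup F] [NormedSpace ℝ F]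
    (u : EuclideanSpace ℝ (Fin d) → F) (x : EuclideanSpace ℝ (Fin d)) : F :=
  ∑ i, fderiv ℝ (fun y => fderiv ℝ u y (EuclideanSpace.single i 1)) x
    (EuclideanSpace.single i 1)

/-- The double commutator `[Δ,[Δ,g]]` applied to `u`:
`[Δ,[Δ,g]]u = Δ(Δ(g·u)) − 2Δ(g·Δu) + g·Δ(Δu)`. -/
noncomputable def doubleCommutator {d : ℕ} (g : EuclideanSpace ℝ (Fin d) → ℝ)
    (u : EuclideanSpace ℝ (Fin d) → ℂ) (x : EuclideanSpace ℝ (Fin d)) : ℂ :=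
  laplacian (laplacian (fun y => (g y : ℂ) * u y)) x
    - 2 * laplacian (fun y => (g y : ℂ) * laplacian u y) x
    + (g x : ℂ) * laplacian (laplacian u) x

open scoped ContDiff Topology

/-- The directional derivative along the `i`-th coordinate vector. -/
noncomputable def coordDeriv {d : ℕ} {F : Type*} [NormedAddCommGroup F] [NormedSpace ℝ F]
    (i : Fin d) (f : EuclideanSpace ℝ (Fin d) → F) (x : EuclideanSpace ℝ (Fin d)) : F :=
  fderiv ℝ f x (EuclideanSpace.single i 1)

section CommutingDerivations

variable {ι R A : Type*} [CommRing R] [CommRing A] [Algebra R A]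

/-- The sum of the squares of a finite family of derivations. -/
def sumSq [Fintype ι] (D : ι → Derivation R A A) (f : A) : A :=
  ∑ i, D i (D i f)

variable [Fintype ι] (D : ι → Derivation R A A)

theorem sumSq_add (f g : A) : sumSq D (f + g) = sumSq D f + sumSq D g := by
  simp [sumSq, Finset.sum_add_distrib]

theorem sumSq_sum {κ : Type*} (s : Finset κ) (f : κ → A) :
    sumSq D (∑ k ∈ s, f k) = ∑ k ∈ s, sumSq D (f k) := by
  simp only [sumSq, map_sum]
  exact Finset.sum_comm

theorem sumSq_mul (f g : A) :
    sumSq D (f * g) = sumSq D f * g + 2 * ∑ i, D i f * D i g + f * sumSq D g := by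
  simp only [sumSq, Finset.sum_mul, Finset.mul_sum, ← Finset.sum_add_distrib]
  refine Finset.sum_congr rfl fun i _ => ?_
  simp only [Derivation.leibniz, map_add, smul_eq_mul]
  ring

variable {D}

theorem sumSq_comm_apply (hD : ∀ i j f, D i (D j f) = D j (D i f)) (i : ι) (f : A) :
    sumSq D (D i f) = D i (sumSq D f) := by
  simp only [sumSq, map_sum]
  refine Finset.sum_congr rfl fun j _ => ?_
  rw [hD j i f, hD j i]

/-- The double commutator of the multiplication by `g` with the sum of squares of commuting
derivations, in divergence form. -/
theorem sumSq_double_commutator (hD : ∀ i j f, D i (D j f) = D j (D i f)) (g u : A) :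
    sumSq D (sumSq D (g * u)) - 2 * sumSq D (g * sumSq D u) + g * sumSq D (sumSq D u)
      = sumSq D (sumSq D g) * u + 4 * ∑ i, D i (∑ j, D j (D i g) * D j u) := by
  have hdiv : ∑ i, D i (∑ j, D j (D i g) * D j u) =
      ∑ i, D i (sumSq D g) * D i u + ∑ i, ∑ j, D j (D i g) * D j (D i u) := by
    have h1 : ∑ i, D i (sumSq D g) * D i u = ∑ i, ∑ j, D i (D j (D i g)) * D j u := by
      rw [Finset.sum_comm]
      refine Finset.sum_congr rfl fun j _ => ?_
      rw [← Finset.sum_mul, ← sumSq_comm_apply hD, sumSq]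
      congr 1
      exact Finset.sum_congr rfl fun i _ => by rw [hD j i g]
    rw [h1, ← Finset.sum_add_distrib]
    refine Finset.sum_congr rfl fun i _ => ?_
    rw [map_sum, ← Finset.sum_add_distrib]
    refine Finset.sum_congr rfl fun j _ => ?_
    rw [Derivation.leibniz, smul_eq_mul, smul_eq_mul, hD i j u]
    ring
  have htwo : ∀ f : A, sumSq D (2 * f) = 2 * sumSq D f := fun f => by
    rw [two_mul, sumSq_add, two_mul]
  rw [hdiv, sumSq_mul D g u, sumSq_add, sumSq_add, htwo, sumSq_sum, sumSq_mul D g (sumSq D u),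
    sumSq_mul D (sumSq D g) u]
  simp only [sumSq_mul D (D _ g), sumSq_comm_apply hD, Finset.sum_add_distrib, ← Finset.mul_sum]
  ring

end CommutingDerivations

section Smooth

variable {d : ℕ}

theorem ContDiff.coordDeriv {F : Type*} [NormedAddCommGroup F] [NormedSpace ℝ F]
    {f : EuclideanSpace ℝ (Fin d) → F} (hf : ContDiff ℝ ∞ f) (i : Fin d) : ContDiff ℝ ∞ (coordDeriv i f) :=
  (hf.fderiv_right (m := ∞) le_rfl).clm_apply contDiff_const

theorem tsupport_coordDeriv_subset {F : Type*} [NormedAddCommGroup F] [NormedSpace ℝ F]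
    (i : Fin d) (f : EuclideanSpace ℝ (Fin d) → F) : tsupport (coordDeriv i f) ⊆ tsupport f :=
  tsupport_fderiv_apply_subset ℝ _

theorem HasCompactSupport.coordDeriv {F : Type*} [NormedAddCommGroup F] [NormedSpace ℝ F]
    {f : EuclideanSpace ℝ (Fin d) → F} (hf : HasCompactSupport f) (i : Fin d) :
    HasCompactSupport (coordDeriv i f) :=
  hf.fderiv_apply ℝ _

theorem coordDeriv_comm {f : EuclideanSpace ℝ (Fin d) → ℂ} (hf : ContDiff ℝ ∞ f) (i j : Fin d) :
    coordDeriv i (coordDeriv j f) = coordDeriv j (coordDeriv i f) := by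
  ext x
  have hd : DifferentiableAt ℝ (fderiv ℝ f) x :=
    ((hf.fderiv_right (m := ∞) le_rfl).differentiable (by simp)).differentiableAt
  have key : ∀ k l : Fin d, coordDeriv k (coordDeriv l f) x =
      fderiv ℝ (fderiv ℝ f) x (EuclideanSpace.single k 1) (EuclideanSpace.single l 1) := by
    intro k l
    change fderiv ℝ (fun y => fderiv ℝ f y (EuclideanSpace.single l 1)) x _ = _
    rw [fderiv_clm_apply hd (differentiableAt_const _)]
    simp
  rw [key, key]
  exact (hf.contDiffAt.isSymmSndFDerivAt (by simpa using WithTop.coe_le_coe.2 (le_top : (2 : ℕ∞) ≤ ⊤))) _ _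

variable (d) in
/-- The algebra of smooth complex-valued functions on `ℝ^d`. -/
def smoothSubalgebra : Subalgebra ℝ (EuclideanSpace ℝ (Fin d) → ℂ) where
  carrier := {f | ContDiff ℝ ∞ f}
  mul_mem' {f g} (hf : ContDiff ℝ ∞ f) (hg : ContDiff ℝ ∞ g) := hf.mul hg
  add_mem' {f g} (hf : ContDiff ℝ ∞ f) (hg : ContDiff ℝ ∞ g) := hf.add hg
  algebraMap_mem' r := (contDiff_const : ContDiff ℝ ∞ fun _ => (algebraMap ℝ ℂ r))

theorem differentiableAt_of_mem (f : smoothSubalgebra d) (x : EuclideanSpace ℝ (Fin d)) :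
    DifferentiableAt ℝ (f : EuclideanSpace ℝ (Fin d) → ℂ) x :=
  (show ContDiff ℝ ∞ (f : EuclideanSpace ℝ (Fin d) → ℂ) from f.2).differentiable (by simp) x

/-- The coordinate derivative as a derivation of the algebra of smooth functions. -/
noncomputable def coordDerivation (i : Fin d) :
    Derivation ℝ (smoothSubalgebra d) (smoothSubalgebra d) :=
  Derivation.mk'
    { toFun := fun f => ⟨coordDeriv i f.1, ContDiff.coordDeriv f.2 i⟩
      map_add' := fun f g => Subtype.ext <| funext fun x => DFunLike.congr_fun
        (fderiv_add (differentiableAt_of_mem f x) (differentiableAt_of_mem g x)) _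
      map_smul' := fun c f => Subtype.ext <| funext fun x => DFunLike.congr_fun
        (fderiv_const_smul (differentiableAt_of_mem f x) c) _ }
    (fun f g => Subtype.ext <| funext fun x => DFunLike.congr_fun
      (fderiv_mul (differentiableAt_of_mem f x) (differentiableAt_of_mem g x)) _)

theorem coe_coordDerivation (i : Fin d) (f : smoothSubalgebra d) :
    (coordDerivation i f : EuclideanSpace ℝ (Fin d) → ℂ) = coordDeriv i f := rfl

theorem coordDerivation_comm (i j : Fin d) (f : smoothSubalgebra d) :
    coordDerivation i (coordDerivation j f) = coordDerivation j (coordDerivation i f) :=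
  Subtype.ext (coordDeriv_comm f.2 i j)

theorem coe_sumSq_coordDerivation (f : smoothSubalgebra d) :
    ((sumSq coordDerivation f : smoothSubalgebra d) : EuclideanSpace ℝ (Fin d) → ℂ) = laplacian f := by
  ext x
  simp [sumSq, laplacian, coe_coordDerivation]
  rfl

/-- The double commutator `[Δ,[Δ,g]]` in divergence form. -/
theorem double_commutator_eq_divergence {g u : EuclideanSpace ℝ (Fin d) → ℂ}
    (hg : ContDiff ℝ ∞ g) (hu : ContDiff ℝ ∞ u) (x : EuclideanSpace ℝ (Fin d)) :
    laplacian (laplacian (fun y => g y * u y)) x - 2 * laplacian (fun y => g y * laplacian u y) x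
        + g x * laplacian (laplacian u) x
      = laplacian (laplacian g) x * u x
        + 4 * ∑ i,
          coordDeriv i (fun y => ∑ j, coordDeriv j (coordDeriv i g) y * coordDeriv j u y) x := by
  have h := congrFun (congrArg Subtype.val (sumSq_double_commutator
    (D := coordDerivation (d := d)) coordDerivation_comm ⟨g, hg⟩ ⟨u, hu⟩)) x
  have hsum : ∀ i, (fun y => ∑ j, coordDeriv j (coordDeriv i g) y * coordDeriv j u y) =
      ((∑ j, coordDerivation j (coordDerivation i ⟨g, hg⟩) * coordDerivation j ⟨u, hu⟩ :
        smoothSubalgebra d) : EuclideanSpace ℝ (Fin d) → ℂ) := fun i => by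
    ext y
    simp [coe_coordDerivation]
  simp only [hsum, ← coe_coordDerivation]
  simp only [Subalgebra.coe_add, Subalgebra.coe_sub, Subalgebra.coe_mul,
    coe_sumSq_coordDerivation, Pi.add_apply, Pi.sub_apply, Pi.mul_apply] at h
  convert h using 2
  · rfl
  · refine congrArg (4 * ·) ?_
    simp
end Smooth

section EventuallyEq

variable {d : ℕ} {F : Type*} [NormedAddCommGroup F] [NormedSpace ℝ F]
  {f g : EuclideanSpace ℝ (Fin d) → F} {x : EuclideanSpace ℝ (Fin d)}

theorem Filter.EventuallyEq.coordDeriv (h : f =ᶠ[𝓝 x] g) (i : Fin d) :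
    coordDeriv i f =ᶠ[𝓝 x] coordDeriv i g :=
  h.fderiv.fun_comp fun l => l (EuclideanSpace.single i 1)

theorem Filter.EventuallyEq.laplacian (h : f =ᶠ[𝓝 x] g) :
    laplacian f =ᶠ[𝓝 x] laplacian g := by
  filter_upwards [eventually_eventually_nhds.2 h] with y hy
  exact Finset.sum_congr rfl fun i _ =>
    (Filter.EventuallyEq.coordDeriv (Filter.EventuallyEq.coordDeriv hy i) i).eq_of_nhds

theorem tsupport_laplacian_subset (f : EuclideanSpace ℝ (Fin d) → F) :
    tsupport (laplacian f) ⊆ tsupport f := by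
  refine closure_minimal (fun x hx => ?_) (isClosed_tsupport f)
  contrapose! hx
  have h := (Filter.EventuallyEq.laplacian (notMem_tsupport_iff_eventuallyEq.1 hx)).eq_of_nhds
  rw [Function.notMem_support, h]
  simp [_root_.laplacian]

end EventuallyEq

section Radial

variable {d : ℕ} {x : EuclideanSpace ℝ (Fin d)}

theorem hasFDerivAt_norm_of_ne_zero {E : Type*} [NormedAddCommGroup E] [InnerProductSpace ℝ E]
    {x : E} (hx : x ≠ 0) : HasFDerivAt (fun y : E => ‖y‖) (‖x‖⁻¹ • innerSL ℝ x) x := by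
  have h := (hasStrictFDerivAt_norm_sq x).hasFDerivAt.sqrt (by simpa using hx)
  simp only [Real.sqrt_sq (norm_nonneg _)] at h
  convert h using 1
  ext v
  simp
  ring

theorem HasFDerivAt.coordDeriv_ofReal {f : EuclideanSpace ℝ (Fin d) → ℝ}
    {f' : EuclideanSpace ℝ (Fin d) →L[ℝ] ℝ} (h : HasFDerivAt f f' x) (i : Fin d) :
    coordDeriv i (fun y => (f y : ℂ)) x = (f' (EuclideanSpace.single i 1) : ℂ) := by
  have := (Complex.ofRealCLM.hasFDerivAt (x := f x)).comp x h
  exact DFunLike.congr_fun this.fderiv (EuclideanSpace.single i 1)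

theorem coordDeriv_norm_pow_three (hx : x ≠ 0) (i : Fin d) :
    coordDeriv i (fun y => ((‖y‖ ^ 3 : ℝ) : ℂ)) x = ((3 * (‖x‖ * x i) : ℝ) : ℂ) := by
  have hx' := norm_ne_zero_iff.2 hx
  rw [((hasFDerivAt_norm_of_ne_zero hx).pow 3).coordDeriv_ofReal]
  congr 1
  simp [EuclideanSpace.inner_single_right]
  field_simp

theorem coordDeriv_coordDeriv_norm_pow_three (hx : x ≠ 0) (i j : Fin d) :
    coordDeriv j (coordDeriv i fun y => ((‖y‖ ^ 3 : ℝ) : ℂ)) x =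
      ((3 * (‖x‖ * (if i = j then 1 else 0) + ‖x‖⁻¹ * x i * x j) : ℝ) : ℂ) := by
  have h : coordDeriv i (fun y => ((‖y‖ ^ 3 : ℝ) : ℂ)) =ᶠ[𝓝 x]
      fun y => ((3 * (‖y‖ * y i) : ℝ) : ℂ) := by
    filter_upwards [eventually_ne_nhds hx] with y hy using coordDeriv_norm_pow_three hy i
  rw [(Filter.EventuallyEq.coordDeriv h j).eq_of_nhds]
  have hi : HasFDerivAt (fun y : EuclideanSpace ℝ (Fin d) => y i)
    (EuclideanSpace.proj i : EuclideanSpace ℝ (Fin d) →L[ℝ] ℝ) x :=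
    (EuclideanSpace.proj i : EuclideanSpace ℝ (Fin d) →L[ℝ] ℝ).hasFDerivAt
  rw [(((hasFDerivAt_norm_of_ne_zero hx).fun_mul hi).const_mul 3).coordDeriv_ofReal]
  congr 1
  simp [EuclideanSpace.inner_single_right]
  split_ifs <;> ring

theorem laplacian_norm_pow_three (hx : x ≠ 0) :
    laplacian (fun y => ((‖y‖ ^ 3 : ℝ) : ℂ)) x = ((3 * (d + 1) * ‖x‖ : ℝ) : ℂ) := by
  have hx' := norm_ne_zero_iff.2 hx
  change ∑ i, coordDeriv i (coordDeriv i _) x = _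
  simp only [coordDeriv_coordDeriv_norm_pow_three hx, ← Complex.ofReal_sum, ← Finset.mul_sum,
    Finset.sum_add_distrib, if_true, mul_assoc, Finset.sum_const, Finset.card_univ, Fintype.card_fin,
    ← EuclideanSpace.real_norm_sq_eq, ← pow_two]
  congr 1
  simp
  field_simp

theorem laplacian_norm (hx : x ≠ 0) (c : ℝ) :
    laplacian (fun y : EuclideanSpace ℝ (Fin d) => ((c * ‖y‖ : ℝ) : ℂ)) x =
      ((c * (d - 1) / ‖x‖ : ℝ) : ℂ) := by
  have hx' := norm_ne_zero_iff.2 hx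
  have h1 : ∀ i, coordDeriv i (fun y : EuclideanSpace ℝ (Fin d) => ((c * ‖y‖ : ℝ) : ℂ)) =ᶠ[𝓝 x]
      fun y => ((c * (‖y‖⁻¹ * y i) : ℝ) : ℂ) := fun i => by
    filter_upwards [eventually_ne_nhds hx] with y hy
    rw [((hasFDerivAt_norm_of_ne_zero hy).const_mul c).coordDeriv_ofReal]
    congr 1
    simp [EuclideanSpace.inner_single_right]
  have h2 : ∀ i, coordDeriv i (coordDeriv i
      (fun y : EuclideanSpace ℝ (Fin d) => ((c * ‖y‖ : ℝ) : ℂ))) x =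
      ((c * (‖x‖⁻¹ - (‖x‖ ^ 3)⁻¹ * x i ^ 2) : ℝ) : ℂ) := fun i => by
    rw [(Filter.EventuallyEq.coordDeriv (h1 i) i).eq_of_nhds]
    have hi : HasFDerivAt (fun y : EuclideanSpace ℝ (Fin d) => y i)
      (EuclideanSpace.proj i : EuclideanSpace ℝ (Fin d) →L[ℝ] ℝ) x :=
      (EuclideanSpace.proj i : EuclideanSpace ℝ (Fin d) →L[ℝ] ℝ).hasFDerivAt
    have hinv : HasFDerivAt (fun y : EuclideanSpace ℝ (Fin d) => ‖y‖⁻¹) _ x :=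
      (hasDerivAt_inv hx').comp_hasFDerivAt x (hasFDerivAt_norm_of_ne_zero hx)
    rw [((hinv.fun_mul hi).const_mul c).coordDeriv_ofReal]
    congr 1
    simp [EuclideanSpace.inner_single_right]
    field_simp
    ring
  change ∑ i, coordDeriv i (coordDeriv i _) x = _
  simp only [h2, ← Complex.ofReal_sum, ← Finset.mul_sum, Finset.sum_sub_distrib, Finset.sum_const,
    Finset.card_univ, Fintype.card_fin, ← EuclideanSpace.real_norm_sq_eq]
  congr 1
  simp
  field_simp

theorem laplacian_laplacian_norm_pow_three (hx : x ≠ 0) :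
    laplacian (laplacian fun y => ((‖y‖ ^ 3 : ℝ) : ℂ)) x =
      ((3 * (d + 1) * (d - 1) / ‖x‖ : ℝ) : ℂ) := by
  have h : laplacian (fun y => ((‖y‖ ^ 3 : ℝ) : ℂ)) =ᶠ[𝓝 x]
      fun y => ((3 * (d + 1) * ‖y‖ : ℝ) : ℂ) := by
    filter_upwards [eventually_ne_nhds hx] with y hy using laplacian_norm_pow_three hy
  rw [(Filter.EventuallyEq.laplacian h).eq_of_nhds, laplacian_norm hx]

end Radial

theorem fderiv_apply_eq_sum_coordDeriv {d : ℕ} {F : Type*} [NormedAddCommGroup F]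
    [NormedSpace ℝ F] (f : EuclideanSpace ℝ (Fin d) → F) (x v : EuclideanSpace ℝ (Fin d)) :
    fderiv ℝ f x v = ∑ i, v i • coordDeriv i f x := by
  conv_lhs => rw [← (EuclideanSpace.basisFun (Fin d) ℝ).sum_repr v]
  simp [coordDeriv]

section Integration

variable {d : ℕ} {u : EuclideanSpace ℝ (Fin d) → ℂ}

theorem coordDeriv_conj (hu : ContDiff ℝ ∞ u) (i : Fin d) (x : EuclideanSpace ℝ (Fin d)) :
    coordDeriv i (fun y => conj (u y)) x = conj (coordDeriv i u x) := by
  have := (Complex.conjCLE.toContinuousLinearMap.hasFDerivAt (x := u x)).comp x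
    (hu.differentiable (by simp) x).hasFDerivAt
  exact DFunLike.congr_fun this.fderiv (EuclideanSpace.single i 1)

theorem integral_conj_mul_coordDeriv (hu : ContDiff ℝ ∞ u) (hc : HasCompactSupport u)
    {F : EuclideanSpace ℝ (Fin d) → ℂ} (hF : ContDiff ℝ ∞ F) (i : Fin d) :
    ∫ x, conj (u x) * coordDeriv i F x = - ∫ x, conj (coordDeriv i u x) * F x := by
  have hu' : ContDiff ℝ ∞ fun y => conj (u y) := Complex.conjCLE.contDiff.comp hu
  have hc' : HasCompactSupport fun y => conj (u y) := hc.comp_left (map_zero _)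
  simp only [← coordDeriv_conj hu]
  refine integral_mul_fderiv_eq_neg_fderiv_mul_of_integrable ?_ ?_ ?_
    (fun x _ => hu'.differentiable (by simp) x) (fun x _ => hF.differentiable (by simp) x)
  · exact ((hu'.coordDeriv i).continuous.mul hF.continuous).integrable_of_hasCompactSupport
      (hc'.coordDeriv i).mul_right
  · exact (hu'.continuous.mul (hF.coordDeriv i).continuous).integrable_of_hasCompactSupport
      hc'.mul_right
  · exact (hu'.continuous.mul hF.continuous).integrable_of_hasCompactSupport hc'.mul_right

theorem ContDiff.laplacian (hu : ContDiff ℝ ∞ u) : ContDiff ℝ ∞ (laplacian u) :=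
  ContDiff.sum fun i _ => (hu.coordDeriv i).coordDeriv i

/-- The quadratic form of `-[Δ,[Δ,g]]` for a smooth weight `g`. -/
theorem neg_integral_conj_mul_double_commutator {g : EuclideanSpace ℝ (Fin d) → ℂ}
    (hg : ContDiff ℝ ∞ g) (hu : ContDiff ℝ ∞ u) (hc : HasCompactSupport u) :
    - ∫ x, conj (u x) * (_root_.laplacian (_root_.laplacian (fun y => g y * u y)) x
          - 2 * _root_.laplacian (fun y => g y * _root_.laplacian u y) x
          + g x * _root_.laplacian (_root_.laplacian u) x) =
      - (∫ x, conj (u x) * (_root_.laplacian (_root_.laplacian g) x * u x)) +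
        4 * ∫ x, ∑ i, conj (coordDeriv i u x) *
          ∑ j, coordDeriv j (coordDeriv i g) x * coordDeriv j u x := by
  have hu' : Continuous fun y => conj (u y) := Complex.continuous_conj.comp hu.continuous
  have hc' : HasCompactSupport fun y => conj (u y) := hc.comp_left (map_zero _)
  have hF : ∀ i, ContDiff ℝ ∞ fun y => ∑ j, coordDeriv j (coordDeriv i g) y * coordDeriv j u y :=
    fun i => ContDiff.sum fun j _ => ((hg.coordDeriv i).coordDeriv j).mul (hu.coordDeriv j)
  have hint : ∀ f : EuclideanSpace ℝ (Fin d) → ℂ, Continuous f →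
      MeasureTheory.Integrable fun x => conj (u x) * f x := fun f hf =>
    (hu'.mul hf).integrable_of_hasCompactSupport hc'.mul_right
  simp only [double_commutator_eq_divergence hg hu, mul_add]
  rw [MeasureTheory.integral_add (hint _ (hg.laplacian.laplacian.mul hu).continuous)
    (hint (fun x => 4 * ∑ i, coordDeriv i _ x) (continuous_const.mul
      (continuous_finsetSum _ fun i _ => ((hF i).coordDeriv i).continuous))), neg_add]
  congr 1
  simp only [mul_left_comm _ (4 : ℂ)]
  rw [MeasureTheory.integral_const_mul, ← mul_neg]
  congr 1
  conv_lhs => simp only [Finset.mul_sum]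
  rw [MeasureTheory.integral_finsetSum _ fun i _ => hint _ ((hF i).coordDeriv i).continuous,
    MeasureTheory.integral_finsetSum _ fun i _ => ?_, ← Finset.sum_neg_distrib]
  · exact Finset.sum_congr rfl fun i _ => by rw [integral_conj_mul_coordDeriv hu hc (hF i), neg_neg]
  · exact ((Complex.continuous_conj.comp (hu.coordDeriv i).continuous).mul
      (hF i).continuous).integrable_of_hasCompactSupport
      ((hc.coordDeriv i).comp_left (g := conj) (map_zero _)).mul_right

end Integration

/-- A function on a Euclidean space that is smooth away from the origin agrees, near a closed set
avoiding the origin, with a globally smooth one. -/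
theorem exists_contDiff_eventuallyEq_of_zero_notMem {E F : Type*} [NormedAddCommGroup E]
    [InnerProductSpace ℝ E] [FiniteDimensional ℝ E] [NormedAddCommGroup F] [NormedSpace ℝ F]
    {f : E → F} (hf : ∀ x ≠ 0, ContDiffAt ℝ ∞ f x) {K : Set E} (hK : IsClosed K)
    (h0 : (0 : E) ∉ K) : ∃ g : E → F, ContDiff ℝ ∞ g ∧ ∀ x ∈ K, g =ᶠ[𝓝 x] f := by
  obtain ⟨δ, hδ, hball⟩ := Metric.isOpen_iff.1 hK.isOpen_compl 0 h0
  let χ : ContDiffBump (0 : E) := ⟨δ / 4, δ / 2, by positivity, by linarith⟩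
  refine ⟨fun x => (1 - χ x) • f x, contDiff_iff_contDiffAt.2 fun x => ?_, fun x hx => ?_⟩
  · rcases eq_or_ne x 0 with rfl | hx
    · refine (contDiffAt_const (c := (0 : F))).congr_of_eventuallyEq ?_
      filter_upwards [χ.eventuallyEq_one] with y hy
      simp [hy]
    · exact (contDiffAt_const.sub χ.contDiffAt).smul (hf x hx)
  · have hx' : δ / 2 < dist x 0 := by
      have : x ∉ Metric.ball 0 δ := fun h => hball h hx
      rw [Metric.mem_ball, not_lt] at this
      linarith
    filter_upwards [(continuous_id.dist continuous_const).continuousAt.eventually_const_lt hx']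
      with y (hy : δ / 2 < dist y 0)
    rw [χ.zero_of_le_dist (le_of_lt hy), sub_zero, one_smul]

/-- Quadratic form identity for the cubic weight in dimension 3:
`−[Δ,[Δ,|x|³]] = −24/|x| − 12 ∇·(|x|(1 + ω_x ω_xᵀ))∇` as quadratic forms on
`C_c^∞(ℝ³ \ {0})`. -/
theorem cubic_weight_quadratic_form_identity (u : EuclideanSpace ℝ (Fin 3) → ℂ)
    (hu : ContDiff ℝ (⊤ : ℕ∞) u) (hsupp : HasCompactSupport u)
    (h0 : (0 : EuclideanSpace ℝ (Fin 3)) ∉ tsupport u) :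
    - ∫ x : EuclideanSpace ℝ (Fin 3),
        conj (u x) * doubleCommutator (fun y => ‖y‖ ^ 3) u x =
      (((- 24 * ∫ x : EuclideanSpace ℝ (Fin 3), ‖u x‖ ^ 2 / ‖x‖)
          + 12 * ∫ x : EuclideanSpace ℝ (Fin 3),
              ‖x‖ * ((∑ i, ‖fderiv ℝ u x (EuclideanSpace.single i 1)‖ ^ 2)
                + ‖fderiv ℝ u x (‖x‖⁻¹ • x)‖ ^ 2) : ℝ) : ℂ) := by
  obtain ⟨g, hg, hgK⟩ := exists_contDiff_eventuallyEq_of_zero_notMem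
    (f := fun y : EuclideanSpace ℝ (Fin 3) => ((‖y‖ ^ 3 : ℝ) : ℂ))
    (fun x hx => Complex.ofRealCLM.contDiff.contDiffAt.comp x ((contDiffAt_norm ℝ hx).pow 3))
    (isClosed_tsupport u) h0
  have hne : ∀ x ∈ tsupport u, x ≠ 0 := fun x hx h => h0 (h ▸ hx)
  have hmul : ∀ w : EuclideanSpace ℝ (Fin 3) → ℂ, tsupport w ⊆ tsupport u →
      ∀ y, ((‖y‖ ^ 3 : ℝ) : ℂ) * w y = g y * w y := fun w hw y => by
    by_cases hy : y ∈ tsupport u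
    · rw [(hgK y hy).eq_of_nhds]
    · rw [image_eq_zero_of_notMem_tsupport fun h => hy (hw h), mul_zero, mul_zero]
  have hlap := tsupport_laplacian_subset u
  have hdc : doubleCommutator (fun y => ‖y‖ ^ 3) u = fun x =>
      laplacian (laplacian (fun y => g y * u y)) x - 2 * laplacian (fun y => g y * laplacian u y) x
        + g x * laplacian (laplacian u) x := by
    ext x
    simp only [doubleCommutator, hmul u subset_rfl, hmul _ hlap,
      hmul _ ((tsupport_laplacian_subset _).trans hlap)]
  rw [hdc, neg_integral_conj_mul_double_commutator hg hu hsupp]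
  simp only [Complex.ofReal_add, Complex.ofReal_mul, ← integral_complex_ofReal]
  congr 1
  · rw [Complex.ofReal_neg, neg_mul, ← MeasureTheory.integral_const_mul]
    congr 2
    ext x
    by_cases hx : x ∈ tsupport u
    · rw [(hgK x hx).laplacian.laplacian.eq_of_nhds,
        laplacian_laplacian_norm_pow_three (hne x hx), mul_left_comm, ← Complex.normSq_eq_conj_mul_self,
        Complex.normSq_eq_norm_sq]
      push_cast
      ring
    · simp [image_eq_zero_of_notMem_tsupport hx]
  · rw [← MeasureTheory.integral_const_mul, ← MeasureTheory.integral_const_mul]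
    congr 1
    ext x
    by_cases hx : x ∈ tsupport u
    · simp only [((hgK x hx).coordDeriv _).coordDeriv _ |>.eq_of_nhds,
        coordDeriv_coordDeriv_norm_pow_three (hne x hx)]
      have hx' : (‖x‖ : ℂ) ≠ 0 := by simpa using hne x hx
      rw [fderiv_apply_eq_sum_coordDeriv]
      have hfold : ∀ i, fderiv ℝ u x (EuclideanSpace.single i 1) = coordDeriv i u x :=
        fun _ => rfl
      simp only [Fin.sum_univ_three, hfold]
      push_cast
      simp only [← Complex.conj_mul', map_add]
      simp
      field_simp
      ring
    · have hz : ∀ i, coordDeriv i u x = 0 := fun i =>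
        image_eq_zero_of_notMem_tsupport fun h => hx (tsupport_coordDeriv_subset i u h)
      have hf : fderiv ℝ u x = 0 :=
        image_eq_zero_of_notMem_tsupport fun h => hx (tsupport_fderiv_subset ℝ h)
      simp [hz, hf]
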